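/- arXiv:1605.03226 — 2 statements merged into one kernel-verified Lean document; each statement's English description precedes it below -/
import Mathlib

section
/- Let α be a circularly ordered type and let Or be its orientation cocycle. Then Or satisfies the homogeneous cocycle identity: for all w, x, y, z ∈ α, Or(x,y,z) − Or(w,y,z) + Or(w,x,z) − Or(w,x,y) = 0. -/
noncomputable section

open Classical in
/-- The orientation cocycle of a circularly ordered type. -/
def orC {α : Type*} [CircularOrder α] (x y z : α) : ℝ :=
  if sbtw x y z then 1 else if sbtw x z y then -1 else 0

theorem sbtw_or_sbtw_of_ne {α : Type*} [CircularOrder α] {a b c : α}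
    (hab : a ≠ b) (hbc : b ≠ c) (hca : c ≠ a) : sbtw a b c ∨ sbtw a c b := by
  by_contra! h
  have h₁ : btw c b a := btw_iff_not_sbtw.2 h.1
  have h₂ : btw b c a := btw_iff_not_sbtw.2 h.2
  have := h₁.antisymm h₂.cyclic_right
  grind

theorem orC_of_sbtw {α : Type*} [CircularOrder α] {a b c : α} (h : sbtw a b c) :
    orC a b c = 1 := if_pos h

theorem orC_swap_right {α : Type*} [CircularOrder α] (a b c : α) :
    orC a c b = -orC a b c := by
  have h : sbtw a b c → ¬sbtw a c b := fun h h' => h.not_sbtw h'.cyclic_left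
  unfold orC
  grind

theorem orC_cyclic {α : Type*} [CircularOrder α] (a b c : α) : orC b c a = orC a b c := by
  have h₁ : sbtw b c a ↔ sbtw a b c := sbtw_cyclic
  have h₂ : sbtw b a c ↔ sbtw a c b := sbtw_cyclic.symm
  unfold orC
  grind

theorem orC_self_right {α : Type*} [CircularOrder α] (a b : α) : orC a b b = 0 := by
  simp [orC, sbtw_irrefl_right]

theorem orC_self_left {α : Type*} [CircularOrder α] (a b : α) : orC a a b = 0 := by
  rw [← orC_cyclic, ← orC_cyclic, orC_self_right]

theorem orC_cocycle_of_sbtw_of_sbtw {α : Type*} [CircularOrder α] {w x y z : α}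
    (hxy : sbtw w x y) (hyz : sbtw w y z) :
    orC x y z - orC w y z + orC w x z - orC w x y = 0 := by
  have hxz : sbtw w x z := hxy.trans_right hyz
  have hxyz : sbtw x y z := (hyz.cyclic_left.trans_right hxy.cyclic_right).cyclic_right
  rw [orC_of_sbtw hxy, orC_of_sbtw hyz, orC_of_sbtw hxz, orC_of_sbtw hxyz]
  norm_num

theorem orientation_cocycle_is_cocycle {α : Type*} [CircularOrder α] (w x y z : α) :
    orC x y z - orC w y z + orC w x z - orC w x y = 0 := by
  have swap := @orC_swap_right α _
  have cyc := @orC_cyclic α _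
  have zl := @orC_self_left α _
  have zr := @orC_self_right α _
  by_cases hwx : w = x
  · subst hwx; grind
  by_cases hwy : w = y
  · subst hwy; grind
  by_cases hwz : w = z
  · subst hwz; grind
  by_cases hxy : x = y
  · subst hxy; grind
  by_cases hyz : y = z
  · subst hyz; grind
  by_cases hxz : x = z
  · subst hxz; grind
  have key := @orC_cocycle_of_sbtw_of_sbtw α _ w
  rcases sbtw_or_sbtw_of_ne hwx hxy (Ne.symm hwy) with h₁ | h₁ <;>
  rcases sbtw_or_sbtw_of_ne hwy hyz (Ne.symm hwz) with h₂ | h₂ <;>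
  rcases sbtw_or_sbtw_of_ne hwx hxz (Ne.symm hwz) with h₃ | h₃ <;>
  grind
end
end

section
/- Let X be a type, α a circularly ordered type with orientation cocycle Or, and f : X → α a map. Define e : X³ → ℝ by e(x,y,z) := (1/2)·Or(f(x), f(y), f(z)), and let e⌢ : C₄(X) → C₂(X) be the linear map sending a tuple (v₀,v₁,v₂,v₃,v₄) to e(v₀,v₁,v₂)·(v₂,v₃,v₄). Let z ∈ C₄(X) be a chain such that for every 5-tuple (v₀,…,v₄) in the support of z the images f(v₀), …, f(v₄) are pairwise distinct. Then there exists a chain c ∈ C₂(X) such that c − e⌢(Alt(z)) lies in the image of the boundary map ∂ : C₃(X) → C₂(X) and ‖c‖₁ ≤ (1/3)·‖z‖₁. -/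
noncomputable section

/-- `Chain X n` is the free `ℝ`-module on `(n+1)`-tuples of elements of `X`. -/
abbrev Chain (X : Type*) (n : ℕ) := (Fin (n + 1) → X) →₀ ℝ

/-- The ℓ¹-norm of a chain: the sum of the absolute values of its coefficients. -/
def l1 {X : Type*} {n : ℕ} (z : Chain X n) : ℝ := z.sum fun _ a => |a|

/-- The alternation operator on chains. -/
def alt {X : Type*} {n : ℕ} (z : Chain X n) : Chain X n :=
  z.sum fun v a =>
    ((Nat.factorial (n + 1) : ℝ))⁻¹ •
      ∑ τ : Equiv.Perm (Fin (n + 1)),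
        (((Equiv.Perm.sign τ : ℤ) : ℝ) * a) • Finsupp.single (v ∘ τ) 1

/-- The simplicial boundary map `C_{n+1}(X) → C_n(X)`, sending a tuple to the
alternating sum of its faces. -/
def bdry {X : Type*} {n : ℕ} (z : Chain X (n + 1)) : Chain X n :=
  z.sum fun v a =>
    ∑ i : Fin (n + 2), ((-1 : ℝ) ^ (i : ℕ) * a) • Finsupp.single (v ∘ i.succAbove) 1

/-- The cap-product-like map `C₄(X) → C₂(X)` induced by a cochain `e : X³ → ℝ`,
sending a tuple `(v₀,…,v₄)` to `e(v₀,v₁,v₂) • (v₂,v₃,v₄)`. -/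
def eCap {X : Type*} (e : X → X → X → ℝ) (z : Chain X 4) : Chain X 2 :=
  z.sum fun v a => (a * e (v 0) (v 1) (v 2)) • Finsupp.single ![v 2, v 3, v 4] 1

theorem l1_add_le {X : Type*} {n : ℕ} (z w : Chain X n) : l1 (z + w) ≤ l1 z + l1 w := by
  classical
  unfold l1
  rw [Finsupp.sum_of_support_subset _ Finsupp.support_add _ (by simp),
    Finsupp.sum_of_support_subset z Finset.subset_union_left _ (by simp),
    Finsupp.sum_of_support_subset w Finset.subset_union_right _ (by simp),
    ← Finset.sum_add_distrib]
  exact Finset.sum_le_sum fun v _ => abs_add_le _ _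

theorem l1_smul {X : Type*} {n : ℕ} (a : ℝ) (z : Chain X n) : l1 (a • z) = |a| * l1 z := by
  unfold l1
  rw [Finsupp.sum_smul_index' (by simp), Finsupp.mul_sum]
  simp [abs_mul]

theorem l1_sum_le {X ι : Type*} {n : ℕ} (s : Finset ι) (z : ι → Chain X n) :
    l1 (∑ i ∈ s, z i) ≤ ∑ i ∈ s, l1 (z i) := by
  classical
  induction s using Finset.induction_on with
  | empty => simp [l1]
  | insert i s hi ih =>
    rw [Finset.sum_insert hi, Finset.sum_insert hi]
    exact (l1_add_le _ _).trans (by gcongr)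

theorem l1_single_one {X : Type*} {n : ℕ} (v : Fin (n + 1) → X) :
    l1 (Finsupp.single v (1 : ℝ)) = 1 := by
  simp [l1]

theorem alt_eq_linearCombination {X : Type*} {n : ℕ} (z : Chain X n) :
    alt z = Finsupp.linearCombination ℝ (fun v : Fin (n + 1) → X =>
      ((Nat.factorial (n + 1) : ℝ))⁻¹ • ∑ τ : Equiv.Perm (Fin (n + 1)),
        ((Equiv.Perm.sign τ : ℤ) : ℝ) • Finsupp.single (v ∘ τ) (1 : ℝ)) z := by
  rw [Finsupp.linearCombination_apply, alt]
  refine Finsupp.sum_congr fun v _ => ?_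
  rw [smul_comm, Finset.smul_sum (r := z v)]
  simp only [smul_smul, mul_comm (z v)]

theorem bdry_eq_linearCombination {X : Type*} {n : ℕ} (z : Chain X (n + 1)) :
    bdry z = Finsupp.linearCombination ℝ (fun v : Fin (n + 2) → X =>
      ∑ i : Fin (n + 2), (-1 : ℝ) ^ (i : ℕ) • Finsupp.single (v ∘ i.succAbove) (1 : ℝ)) z := by
  rw [Finsupp.linearCombination_apply, bdry]
  refine Finsupp.sum_congr fun v _ => ?_
  rw [Finset.smul_sum]
  simp only [smul_smul, mul_comm (z v)]

theorem eCap_eq_linearCombination {X : Type*} (e : X → X → X → ℝ) (z : Chain X 4) :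
    eCap e z = Finsupp.linearCombination ℝ (fun v : Fin 5 → X =>
      e (v 0) (v 1) (v 2) • Finsupp.single ![v 2, v 3, v 4] (1 : ℝ)) z := by
  rw [Finsupp.linearCombination_apply, eCap]
  simp only [smul_smul]

/-- The cone operator `C_n(X) → C_{n+1}(X)` with apex `x`. -/
def cone {X : Type*} {n : ℕ} (x : X) : Chain X n →ₗ[ℝ] Chain X (n + 1) :=
  Finsupp.linearCombination ℝ fun v => Finsupp.single (Fin.cons x v : Fin (n + 2) → X) (1 : ℝ)

theorem bdry_cone {X : Type*} {n : ℕ} (x : X) (z : Chain X (n + 1)) :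
    bdry (cone x z) = z - cone x (bdry z) := by
  simp only [bdry_eq_linearCombination]
  induction z using Finsupp.induction_linear with
  | zero => simp
  | add z w hz hw => simp only [map_add, hz, hw]; abel
  | single v a =>
    have hcons (i : Fin (n + 2)) : (Fin.cons x v : Fin (n + 3) → X) ∘ i.succ.succAbove =
        Fin.cons x (v ∘ i.succAbove) := by
      funext j
      refine Fin.cases ?_ (fun k => ?_) j <;> simp
    have hcons_zero : (Fin.cons x v : Fin (n + 3) → X) ∘ (0 : Fin (n + 3)).succAbove = v := by
      funext j; simp
    rw [← mul_one a, ← smul_eq_mul, ← Finsupp.smul_single]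
    simp only [map_smul, ← smul_sub]
    congr 1
    simp only [cone, Finsupp.linearCombination_single, one_smul, map_sum, map_smul]
    rw [Fin.sum_univ_succ]
    simp only [hcons, hcons_zero, Fin.val_succ, pow_succ, Fin.val_zero, pow_zero, one_smul,
      mul_neg_one, neg_smul, Finset.sum_neg_distrib, sub_eq_add_neg]

theorem exists_bdry_eq_of_bdry_eq_zero {X : Type*} {n : ℕ} {z : Chain X (n + 1)}
    (hz : bdry z = 0) : ∃ b : Chain X (n + 2), bdry b = z := by
  rcases isEmpty_or_nonempty X with hX | ⟨⟨x⟩⟩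
  · refine ⟨0, ?_⟩
    ext v
    exact hX.elim (v 0)
  · exact ⟨cone x z, by rw [bdry_cone, hz, map_zero, sub_zero]⟩

section Orientation

variable {α : Type*} [CircularOrder α]

theorem orC_cyclic_s7 (x y z : α) : orC x y z = orC y z x := by
  have h₁ : sbtw x y z ↔ sbtw y z x := ⟨fun h => h.cyclic_left, fun h => h.cyclic_right⟩
  have h₂ : sbtw x z y ↔ sbtw y x z := ⟨fun h => h.cyclic_right, fun h => h.cyclic_left⟩
  unfold orC
  split_ifs <;> simp_all

theorem orC_swap (x y z : α) : orC x z y = -orC x y z := by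
  have h : sbtw x y z → ¬ sbtw x z y := fun h h' => h.not_sbtw h'.cyclic_left
  by_cases h₁ : sbtw x y z <;> by_cases h₂ : sbtw x z y <;> simp_all [orC]

theorem sbtw_or_sbtw_of_ne_s7 {x y z : α} (hxy : x ≠ y) (hyz : y ≠ z) (hxz : x ≠ z) :
    sbtw x y z ∨ sbtw x z y := by
  by_contra! h
  have h₁ : btw z y x := by
    by_contra h'
    exact h.1 (sbtw_iff_not_btw.2 h')
  have h₂ : btw y z x := by
    by_contra h'
    exact h.2 (sbtw_iff_not_btw.2 h')
  rcases btw_antisymm h₁ h₂.cyclic_left.cyclic_left with h | h | h <;> simp_all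

theorem orC_sq {x y z : α} (hxy : x ≠ y) (hyz : y ≠ z) (hxz : x ≠ z) : orC x y z ^ 2 = 1 := by
  rcases sbtw_or_sbtw_of_ne_s7 hxy hyz hxz with h | h
  · simp [orC, h]
  · have : orC x z y = 1 := by simp [orC, h]
    rw [orC_swap] at this
    nlinarith

theorem orC_cocycle {w x y z : α} (hwx : w ≠ x) (hwy : w ≠ y) (hwz : w ≠ z) (hxy : x ≠ y)
    (hxz : x ≠ z) (hyz : y ≠ z) : orC x y z - orC w y z + orC w x z - orC w x y = 0 := by
  have hor {a b c : α} (h : sbtw a b c) : orC a b c = 1 := by simp [orC, h]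
  have hor' {a b c : α} (h : sbtw a c b) : orC a b c = -1 := by rw [orC_swap, hor h]
  have hcyc {a b c : α} (h : sbtw a b c) : sbtw b c a := h.cyclic_left
  have hasymm {a b c : α} (h : sbtw a b c) : ¬ sbtw a c b := fun h' => h.not_sbtw h'.cyclic_left
  have htrans {a b c d : α} (h : sbtw a b c) (h' : sbtw a c d) : sbtw a b d := h.trans_right h'
  rcases sbtw_or_sbtw_of_ne_s7 hxy hyz hxz with h₁ | h₁ <;>
  rcases sbtw_or_sbtw_of_ne_s7 hwy hyz hwz with h₂ | h₂ <;>
  rcases sbtw_or_sbtw_of_ne_s7 hwx hxz hwz with h₃ | h₃ <;>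
  rcases sbtw_or_sbtw_of_ne_s7 hwx hxy hwy with h₄ | h₄ <;>
  simp only [hor, hor', h₁, h₂, h₃, h₄] <;> first | (norm_num; done) | (exfalso; grind)

end Orientation


/-- Sums over permutations of five letters of functions of the letters are unchanged by
reindexing. -/
theorem sum_perm_mul_right {M : Type*} [AddCommMonoid M]
    (ρ : Equiv.Perm (Fin 5)) (F : Equiv.Perm (Fin 5) → M) : ∑ τ, F (τ * ρ) = ∑ τ, F τ :=
  Equiv.sum_comp (Equiv.mulRight ρ) F

section Antisymmetric

variable {o : Fin 5 → Fin 5 → Fin 5 → ℝ}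

theorem sum_perm_abs_le (hcyc : ∀ i j k, o i j k = o j k i) (hswap : ∀ i j k, o i k j = -o i j k)
    (hsq : ∀ i j k, i ≠ j → j ≠ k → i ≠ k → o i j k ^ 2 = 1)
    (hcoc : ∀ h i j k, h ≠ i → h ≠ j → h ≠ k → i ≠ j → i ≠ k → j ≠ k →
      o i j k - o h j k + o h i k - o h i j = 0) :
    ∑ τ : Equiv.Perm (Fin 5), |o (τ 0) (τ 1) (τ 2) + o (τ 0) (τ 1) (τ 3) + o (τ 0) (τ 1) (τ 4)| ≤
      240 := by
  have hs (τ : Equiv.Perm (Fin 5)) (i j k : Fin 5) (hij : i ≠ j) (hjk : j ≠ k) (hik : i ≠ k) :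
      o (τ i) (τ j) (τ k) ^ 2 = 1 :=
    hsq _ _ _ (τ.injective.ne hij) (τ.injective.ne hjk) (τ.injective.ne hik)
  set Q : ℝ := ∑ τ : Equiv.Perm (Fin 5), o (τ 0) (τ 1) (τ 2) * o (τ 0) (τ 1) (τ 3) with hQ_def
  have hQ (ρ : Equiv.Perm (Fin 5)) : ∑ τ : Equiv.Perm (Fin 5),
      o (τ (ρ 0)) (τ (ρ 1)) (τ (ρ 2)) * o (τ (ρ 0)) (τ (ρ 1)) (τ (ρ 3)) = Q :=
    sum_perm_mul_right ρ fun τ => o (τ 0) (τ 1) (τ 2) * o (τ 0) (τ 1) (τ 3)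
  -- On four points, the six products of values on triangles sharing an edge sum to `2`.
  have hfour : 6 * Q = 240 := by
    have h₁ := hQ ⟨![2, 3, 1, 0, 4], ![3, 2, 0, 1, 4], by decide, by decide⟩
    have h₂ := hQ ⟨![3, 1, 2, 0, 4], ![3, 1, 2, 0, 4], by decide, by decide⟩
    have h₃ := hQ ⟨![1, 2, 3, 0, 4], ![3, 0, 1, 2, 4], by decide, by decide⟩
    have h₄ := hQ ⟨![0, 3, 2, 1, 4], ![0, 3, 2, 1, 4], by decide, by decide⟩
    have h₅ := hQ ⟨![0, 2, 3, 1, 4], ![0, 3, 1, 2, 4], by decide, by decide⟩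
    have hτ (τ : Equiv.Perm (Fin 5)) :
        o (τ 2) (τ 3) (τ 1) * o (τ 2) (τ 3) (τ 0) + o (τ 3) (τ 1) (τ 2) * o (τ 3) (τ 1) (τ 0) +
        o (τ 1) (τ 2) (τ 3) * o (τ 1) (τ 2) (τ 0) + o (τ 0) (τ 3) (τ 2) * o (τ 0) (τ 3) (τ 1) +
        o (τ 0) (τ 2) (τ 3) * o (τ 0) (τ 2) (τ 1) + o (τ 0) (τ 1) (τ 2) * o (τ 0) (τ 1) (τ 3) =
        2 := by
      have hne {i j : Fin 5} (h : i ≠ j) : τ i ≠ τ j := τ.injective.ne h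
      have hc := hcoc (τ 0) (τ 1) (τ 2) (τ 3) (hne (by decide)) (hne (by decide))
        (hne (by decide)) (hne (by decide)) (hne (by decide)) (hne (by decide))
      have s₁ := hs τ 1 2 3 (by decide) (by decide) (by decide)
      have s₂ := hs τ 0 2 3 (by decide) (by decide) (by decide)
      have s₃ := hs τ 0 1 3 (by decide) (by decide) (by decide)
      have s₄ := hs τ 0 1 2 (by decide) (by decide) (by decide)
      have e₁ : o (τ 2) (τ 3) (τ 1) = o (τ 1) (τ 2) (τ 3) := (hcyc _ _ _).symm
      have e₂ : o (τ 2) (τ 3) (τ 0) = o (τ 0) (τ 2) (τ 3) := (hcyc _ _ _).symm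
      have e₃ : o (τ 3) (τ 1) (τ 2) = o (τ 1) (τ 2) (τ 3) := hcyc _ _ _
      have e₄ : o (τ 3) (τ 1) (τ 0) = -o (τ 0) (τ 1) (τ 3) := by rw [← hcyc, hswap]
      have e₅ : o (τ 1) (τ 2) (τ 0) = o (τ 0) (τ 1) (τ 2) := (hcyc _ _ _).symm
      have e₆ := hswap (τ 0) (τ 2) (τ 3)
      have e₇ := hswap (τ 0) (τ 1) (τ 3)
      have e₈ := hswap (τ 0) (τ 1) (τ 2)
      rw [e₁, e₂, e₃, e₄, e₅, e₆, e₇, e₈]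
      generalize o (τ 1) (τ 2) (τ 3) = A at *
      generalize o (τ 0) (τ 2) (τ 3) = B at *
      generalize o (τ 0) (τ 1) (τ 3) = C at *
      generalize o (τ 0) (τ 1) (τ 2) = D at *
      linear_combination (-1 / 2 : ℝ) * (A - B + C - D) * hc + (s₁ + s₂ + s₃ + s₄) / 2
    have hsum := Finset.sum_congr (rfl : (Finset.univ : Finset (Equiv.Perm (Fin 5))) = _)
      fun τ _ => hτ τ
    simp only [Finset.sum_add_distrib, Finset.sum_const, Finset.card_univ, Fintype.card_perm,
      Fintype.card_fin, nsmul_eq_mul] at hsum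
    norm_num [Nat.factorial] at hsum
    simp only [Equiv.coe_fn_mk] at h₁ h₂ h₃ h₄ h₅
    change ∑ τ : Equiv.Perm (Fin 5), o (τ 2) (τ 3) (τ 1) * o (τ 2) (τ 3) (τ 0) = Q at h₁
    change ∑ τ : Equiv.Perm (Fin 5), o (τ 3) (τ 1) (τ 2) * o (τ 3) (τ 1) (τ 0) = Q at h₂
    change ∑ τ : Equiv.Perm (Fin 5), o (τ 1) (τ 2) (τ 3) * o (τ 1) (τ 2) (τ 0) = Q at h₃
    change ∑ τ : Equiv.Perm (Fin 5), o (τ 0) (τ 3) (τ 2) * o (τ 0) (τ 3) (τ 1) = Q at h₄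
    change ∑ τ : Equiv.Perm (Fin 5), o (τ 0) (τ 2) (τ 3) * o (τ 0) (τ 2) (τ 1) = Q at h₅
    linarith
  have h₂₄ : ∑ τ : Equiv.Perm (Fin 5), o (τ 0) (τ 1) (τ 2) * o (τ 0) (τ 1) (τ 4) = Q :=
    hQ ⟨![0, 1, 2, 4, 3], ![0, 1, 2, 4, 3], by decide, by decide⟩
  have h₃₄ : ∑ τ : Equiv.Perm (Fin 5), o (τ 0) (τ 1) (τ 3) * o (τ 0) (τ 1) (τ 4) = Q :=
    hQ ⟨![0, 1, 3, 4, 2], ![0, 1, 4, 2, 3], by decide, by decide⟩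
  have hτ (τ : Equiv.Perm (Fin 5)) :
      |o (τ 0) (τ 1) (τ 2) + o (τ 0) (τ 1) (τ 3) + o (τ 0) (τ 1) (τ 4)| ≤
      3 / 2 + (o (τ 0) (τ 1) (τ 2) * o (τ 0) (τ 1) (τ 3) + o (τ 0) (τ 1) (τ 2) * o (τ 0) (τ 1) (τ 4)
        + o (τ 0) (τ 1) (τ 3) * o (τ 0) (τ 1) (τ 4)) / 2 := by
    rcases sq_eq_one_iff.1 (hs τ 0 1 2 (by decide) (by decide) (by decide))
      with h₁ | h₁ <;>
    rcases sq_eq_one_iff.1 (hs τ 0 1 3 (by decide) (by decide) (by decide))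
      with h₂ | h₂ <;>
    rcases sq_eq_one_iff.1 (hs τ 0 1 4 (by decide) (by decide) (by decide))
      with h₃ | h₃ <;>
    simp only [h₁, h₂, h₃] <;> norm_num [abs_le]
  refine (Finset.sum_le_sum fun τ _ => hτ τ).trans (le_of_eq ?_)
  simp only [Finset.sum_add_distrib, ← Finset.sum_div, h₂₄, h₃₄, ← hQ_def, Finset.sum_const,
    Finset.card_univ, Fintype.card_perm, Fintype.card_fin, nsmul_eq_mul]
  norm_num [Nat.factorial]
  linarith

theorem sum_perm_sign_smul_eq_zero {M : Type*} [AddCommGroup M] [Module ℝ M]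
    (hcyc : ∀ i j k, o i j k = o j k i)
    (hcoc : ∀ h i j k, h ≠ i → h ≠ j → h ≠ k → i ≠ j → i ≠ k → j ≠ k →
      o i j k - o h j k + o h i k - o h i j = 0) (hswap : ∀ i j k, o i k j = -o i j k)
    (G : Fin 5 → Fin 5 → M) :
    ∑ τ : Equiv.Perm (Fin 5), ((Equiv.Perm.sign τ : ℤ) : ℝ) •
      (o (τ 0) (τ 1) (τ 3) + o (τ 0) (τ 1) (τ 4) - 2 * o (τ 0) (τ 1) (τ 2)) •
        (G (τ 3) (τ 4) - G (τ 2) (τ 4) + G (τ 2) (τ 3)) = 0 := by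
  have hsign (ρ : Equiv.Perm (Fin 5)) (F : Equiv.Perm (Fin 5) → M) :
      ∑ τ : Equiv.Perm (Fin 5), ((Equiv.Perm.sign τ : ℤ) : ℝ) • F (τ * ρ) =
      ((Equiv.Perm.sign ρ : ℤ) : ℝ) •
        ∑ τ : Equiv.Perm (Fin 5), ((Equiv.Perm.sign τ : ℤ) : ℝ) • F τ := by
    rw [← sum_perm_mul_right ρ fun τ => ((Equiv.Perm.sign τ : ℤ) : ℝ) • F τ, Finset.smul_sum]
    refine Finset.sum_congr rfl fun τ _ => ?_
    rw [smul_smul, Equiv.Perm.sign_mul, ← Int.cast_mul, ← Units.val_mul, mul_left_comm,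
      Int.units_mul_self, mul_one]
  let c₃ : Equiv.Perm (Fin 5) := ⟨![0, 1, 4, 2, 3], ![0, 1, 3, 4, 2], by decide, by decide⟩
  let c₀ : Equiv.Perm (Fin 5) := ⟨![1, 2, 0, 3, 4], ![2, 0, 1, 3, 4], by decide, by decide⟩
  have s₃ : Equiv.Perm.sign c₃ = 1 := by decide
  have s₀ : Equiv.Perm.sign c₀ = 1 := by decide
  have s₂ : Equiv.Perm.sign (Equiv.swap (2 : Fin 5) 3) = -1 := by decide
  have h₂₄ := hsign (Equiv.swap 2 3) fun τ =>
    (o (τ 0) (τ 1) (τ 2) + o (τ 0) (τ 1) (τ 4) - 2 * o (τ 0) (τ 1) (τ 3)) • G (τ 3) (τ 4)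
  have h₂₃ := hsign c₃ fun τ =>
    (o (τ 0) (τ 1) (τ 4) + o (τ 0) (τ 1) (τ 2) - 2 * o (τ 0) (τ 1) (τ 3)) • G (τ 3) (τ 4)
  -- Averaging over cyclic permutations of the first three letters removes the last letter.
  have havg : ∑ τ : Equiv.Perm (Fin 5), ((Equiv.Perm.sign τ : ℤ) : ℝ) •
      (o (τ 0) (τ 1) (τ 3) - o (τ 0) (τ 1) (τ 4)) • G (τ 3) (τ 4) = 0 := by
    let F (τ : Equiv.Perm (Fin 5)) : M :=
      (o (τ 0) (τ 1) (τ 3) - o (τ 0) (τ 1) (τ 4)) • G (τ 3) (τ 4)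
    have h₁ := hsign c₀ F
    have h₂ := hsign (c₀ * c₀) F
    rw [Equiv.Perm.sign_mul, s₀] at h₂
    rw [s₀] at h₁
    simp only [mul_one, Units.val_one, Int.cast_one, one_smul] at h₁ h₂
    have hzero : ∑ τ : Equiv.Perm (Fin 5), ((Equiv.Perm.sign τ : ℤ) : ℝ) • F τ +
        ∑ τ : Equiv.Perm (Fin 5), ((Equiv.Perm.sign τ : ℤ) : ℝ) • F (τ * c₀) +
        ∑ τ : Equiv.Perm (Fin 5), ((Equiv.Perm.sign τ : ℤ) : ℝ) • F (τ * (c₀ * c₀)) = 0 := by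
      rw [← Finset.sum_add_distrib, ← Finset.sum_add_distrib]
      refine Finset.sum_eq_zero fun τ _ => ?_
      change _ • (_ • G (τ 3) (τ 4)) +
        _ • ((o (τ 1) (τ 2) (τ 3) - o (τ 1) (τ 2) (τ 4)) • G (τ 3) (τ 4)) +
        _ • ((o (τ 2) (τ 0) (τ 3) - o (τ 2) (τ 0) (τ 4)) • G (τ 3) (τ 4)) = 0
      rw [← smul_add, ← smul_add, ← add_smul, ← add_smul]
      have hne {i j : Fin 5} (h : i ≠ j) : τ i ≠ τ j := τ.injective.ne h
      have hc (k : Fin 5) (h₀ : 0 ≠ k) (h₁ : 1 ≠ k) (h₂ : 2 ≠ k) :=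
        hcoc (τ 0) (τ 1) (τ 2) (τ k) (hne (by decide)) (hne (by decide))
          (hne h₀) (hne (by decide)) (hne h₁) (hne h₂)
      have ha (k : Fin 5) : o (τ 2) (τ 0) (τ k) = - o (τ 0) (τ 2) (τ k) := by
        rw [hcyc, hswap]
      have hz : o (τ 0) (τ 1) (τ 3) - o (τ 0) (τ 1) (τ 4) +
          (o (τ 1) (τ 2) (τ 3) - o (τ 1) (τ 2) (τ 4)) +
          (o (τ 2) (τ 0) (τ 3) - o (τ 2) (τ 0) (τ 4)) = 0 := by
        rw [ha, ha]
        linarith [hc 3 (by decide) (by decide) (by decide),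
          hc 4 (by decide) (by decide) (by decide)]
      rw [hz, zero_smul, smul_zero]
    rw [h₁, h₂] at hzero
    have h₃ : (3 : ℝ) • ∑ τ : Equiv.Perm (Fin 5), ((Equiv.Perm.sign τ : ℤ) : ℝ) • F τ = 0 := by
      rw [← hzero]; module
    exact (smul_eq_zero.1 h₃).resolve_left (by norm_num)
  rw [s₂] at h₂₄
  rw [s₃] at h₂₃
  change ∑ τ : Equiv.Perm (Fin 5), ((Equiv.Perm.sign τ : ℤ) : ℝ) •
    (o (τ 0) (τ 1) (τ 3) + o (τ 0) (τ 1) (τ 4) - 2 * o (τ 0) (τ 1) (τ 2)) • G (τ 2) (τ 4) = _ at h₂₄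
  change ∑ τ : Equiv.Perm (Fin 5), ((Equiv.Perm.sign τ : ℤ) : ℝ) •
    (o (τ 0) (τ 1) (τ 3) + o (τ 0) (τ 1) (τ 4) - 2 * o (τ 0) (τ 1) (τ 2)) • G (τ 2) (τ 3) = _ at h₂₃
  simp only [smul_add, smul_sub, Finset.sum_add_distrib, Finset.sum_sub_distrib]
  rw [h₂₄, h₂₃]
  refine Eq.trans ?_ ((congrArg ((-3 : ℝ) • ·) havg).trans (smul_zero _))
  simp only [Units.val_neg, Units.val_one, Int.cast_neg, Int.cast_one, neg_smul, one_smul,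
    ← Finset.sum_sub_distrib, ← Finset.sum_add_distrib, Finset.smul_sum]
  refine Finset.sum_congr rfl fun τ _ => ?_
  module

end Antisymmetric

theorem euler_cap_norm_le_third {X α : Type*} [CircularOrder α] (f : X → α)
    (z : Chain X 4)
    (hz : ∀ v ∈ z.support, ∀ i j : Fin 5, i ≠ j → f (v i) ≠ f (v j)) :
    ∃ c : Chain X 2,
      (∃ b : Chain X 3,
        bdry b = c - eCap (fun x y z' => (1 / 2 : ℝ) * orC (f x) (f y) (f z')) (alt z)) ∧
      l1 c ≤ (1 / 3 : ℝ) * l1 z := by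
  let s (τ : Equiv.Perm (Fin 5)) : ℝ := ((Equiv.Perm.sign τ : ℤ) : ℝ)
  let o (v : Fin 5 → X) (i j k : Fin 5) : ℝ := orC (f (v i)) (f (v j)) (f (v k))
  let S (v : Fin 5 → X) (τ : Equiv.Perm (Fin 5)) : ℝ :=
    o v (τ 0) (τ 1) (τ 2) + o v (τ 0) (τ 1) (τ 3) + o v (τ 0) (τ 1) (τ 4)
  let t (v : Fin 5 → X) (τ : Equiv.Perm (Fin 5)) : Chain X 2 :=
    Finsupp.single ![v (τ 2), v (τ 3), v (τ 4)] 1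
  let c (v : Fin 5 → X) : Chain X 2 := (1 / 720 : ℝ) • ∑ τ, s τ • S v τ • t v τ
  have hcyc (v : Fin 5 → X) (i j k : Fin 5) : o v i j k = o v j k i := orC_cyclic_s7 _ _ _
  have hswap (v : Fin 5 → X) (i j k : Fin 5) : o v i k j = -o v i j k := orC_swap _ _ _
  have hcoc (v : Fin 5 → X) (hv : v ∈ z.support) (h i j k : Fin 5) (hhi : h ≠ i) (hhj : h ≠ j)
      (hhk : h ≠ k) (hij : i ≠ j) (hik : i ≠ k) (hjk : j ≠ k) :
      o v i j k - o v h j k + o v h i k - o v h i j = 0 :=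
    orC_cocycle (hz v hv _ _ hhi) (hz v hv _ _ hhj) (hz v hv _ _ hhk) (hz v hv _ _ hij)
      (hz v hv _ _ hik) (hz v hv _ _ hjk)
  refine ⟨Finsupp.linearCombination ℝ c z, exists_bdry_eq_of_bdry_eq_zero ?_, ?_⟩
  · rw [bdry_eq_linearCombination, eCap_eq_linearCombination, alt_eq_linearCombination]
    simp only [Finsupp.linearCombination_apply ℝ z, Finsupp.sum, map_sum, map_smul, map_sub,
      ← Finset.sum_sub_distrib, ← smul_sub]
    refine Finset.sum_eq_zero fun v hv => ?_
    refine smul_eq_zero_of_right _ ?_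
    have key := sum_perm_sign_smul_eq_zero (hcyc v) (hcoc v hv) (hswap v)
      fun i j => (Finsupp.single ![v i, v j] 1 : Chain X 1)
    refine Eq.trans ?_ ((congrArg ((1 / 720 : ℝ) • ·) key).trans (smul_zero _))
    simp only [c, map_smul, map_sum, Finsupp.linearCombination_single, one_smul, Finset.smul_sum,
      ← Finset.sum_sub_distrib]
    refine Finset.sum_congr rfl fun τ _ => ?_
    have hbdry (x y w : X) : (∑ i : Fin (1 + 2), (-1 : ℝ) ^ (i : ℕ) •
        Finsupp.single (![x, y, w] ∘ i.succAbove) (1 : ℝ) : Chain X 1) =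
        Finsupp.single ![y, w] 1 - Finsupp.single ![x, w] 1 + Finsupp.single ![x, y] 1 := by
      have h₀ : ![x, y, w] ∘ (0 : Fin 3).succAbove = ![y, w] := by
        funext i; fin_cases i <;> rfl
      have h₁ : ![x, y, w] ∘ (1 : Fin 3).succAbove = ![x, w] := by
        funext i; fin_cases i <;> rfl
      have h₂ : ![x, y, w] ∘ (2 : Fin 3).succAbove = ![x, y] := by
        funext i; fin_cases i <;> rfl
      refine (Fin.sum_univ_three _).trans ?_
      rw [h₀, h₁, h₂]
      simp [sub_eq_add_neg]
    simp only [t, S, s, o, Finsupp.linearCombination_single, one_smul, hbdry,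
      Function.comp_apply]
    have hfact : ((Nat.factorial (4 + 1) : ℕ) : ℝ) = 120 := by norm_num [Nat.factorial]
    rw [hfact]
    simp only [← Finset.smul_sum, hbdry]
    module
  · rw [Finsupp.linearCombination_apply, Finsupp.sum,
      show l1 z = ∑ v ∈ z.support, |z v| from rfl, Finset.mul_sum]
    refine (l1_sum_le _ _).trans (Finset.sum_le_sum fun v hv => ?_)
    rw [l1_smul, mul_comm]
    gcongr
    have hS := sum_perm_abs_le (hcyc v) (hswap v)
      (fun i j k hij hjk hik => orC_sq (hz v hv _ _ hij) (hz v hv _ _ hjk) (hz v hv _ _ hik))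
      (hcoc v hv)
    have hle : l1 (∑ τ, s τ • S v τ • t v τ) ≤ 240 := by
      refine (l1_sum_le _ _).trans (le_trans (le_of_eq ?_) hS)
      refine Finset.sum_congr rfl fun τ _ => ?_
      have hsτ : |s τ| = 1 := by
        rcases Int.units_eq_one_or (Equiv.Perm.sign τ) with h | h <;> simp [s, h]
      rw [l1_smul, l1_smul, l1_single_one, hsτ, one_mul, mul_one]
    rw [l1_smul, abs_of_pos (by norm_num)]
    linarith
end
end
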